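/- Let c ∈ ℝ, let q ∈ [0,1] be a constant, and let (p_n) be a sequence in [0,1] with n·p_n − log n → c. Then limsup_{n→∞} P(G_{n,p_n,q} ∈ D^n) ≤ 1 − (1−q)² · e^{−2(1−q)e^{−c}} · e^{−2c}, where G_{n,p_n,q} is a digraph drawn from the random digraph model G(n, p_n, q) and D^n is the set of structurally diagonalizable n-vertex digraphs. -/

import Mathlib

open Finset Filter

/-- A matching in the bipartite representation of a digraph on `Fin n`:
a set of edges no two of which share a left endpoint or share a right endpoint. -/
def IsMatching (n : ℕ) (M : Finset (Fin n × Fin n)) : Prop :=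
  ∀ e ∈ M, ∀ f ∈ M, (e.1 = f.1 ∨ e.2 = f.2) → e = f

/-- `M` is a maximum matching of the bipartite representation of the digraph
with edge set `E`. -/
def IsMaxMatching (n : ℕ) (E M : Finset (Fin n × Fin n)) : Prop :=
  M ⊆ E ∧ IsMatching n M ∧ ∀ M' ⊆ E, IsMatching n M' → M'.card ≤ M.card

/-- The digraph `(V, M)` is a disjoint union of directed cycles and isolated
vertices: `M` is the graph of a permutation restricted to an invariant set `S`,
all vertices outside `S` being isolated. -/
def CyclesAndIsolated (n : ℕ) (M : Finset (Fin n × Fin n)) : Prop :=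
  ∃ σ : Equiv.Perm (Fin n), ∃ S : Finset (Fin n),
    (∀ u ∈ S, σ u ∈ S) ∧ M = S.image fun u => (u, σ u)

/-- A digraph is structurally diagonalizable if its bipartite representation has a
maximum matching `M` such that `(V, M)` is a disjoint union of directed cycles
and isolated vertices. -/
def StructurallyDiagonalizable (n : ℕ) (E : Finset (Fin n × Fin n)) : Prop :=
  ∃ M, IsMaxMatching n E M ∧ CyclesAndIsolated n M

/-- A Hamiltonian decomposition: a spanning subgraph that is a disjoint union of
directed cycles covering all `n` vertices, i.e. the functional graph of a
permutation contained in `E`. -/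
def HasHamiltonianDecomposition (n : ℕ) (E : Finset (Fin n × Fin n)) : Prop :=
  ∃ σ : Equiv.Perm (Fin n), ∀ u, (u, σ u) ∈ E

/-- A consistent matching of the bipartite representation of `E`: a matching whose
set of left endpoints equals its set of right endpoints. -/
def IsConsistentMatching (n : ℕ) (E M : Finset (Fin n × Fin n)) : Prop :=
  M ⊆ E ∧ IsMatching n M ∧ M.image Prod.fst = M.image Prod.snd

/-- Neighborhood, on the right side, of a set `I` of left vertices of `B(G)`. -/
def leftNbhd (n : ℕ) (E : Finset (Fin n × Fin n)) (I : Finset (Fin n)) :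
    Finset (Fin n) :=
  Finset.univ.filter fun v => ∃ u ∈ I, (u, v) ∈ E

/-- Neighborhood, on the left side, of a set `I` of right vertices of `B(G)`. -/
def rightNbhd (n : ℕ) (E : Finset (Fin n × Fin n)) (I : Finset (Fin n)) :
    Finset (Fin n) :=
  Finset.univ.filter fun u => ∃ v ∈ I, (u, v) ∈ E

/-- Membership in `F_k^n`: (1) some subset `I` of one side of `B(G)` has `|I| = k`
and `|N(I)| = k - 1`; (2) no subset `J` of either side with `|J| < k` satisfies
`|N(J)| = |J| - 1`. -/
def memF (n k : ℕ) (E : Finset (Fin n × Fin n)) : Prop :=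
  (∃ I : Finset (Fin n), I.card = k ∧
      ((leftNbhd n E I).card + 1 = k ∨ (rightNbhd n E I).card + 1 = k)) ∧
  ∀ J : Finset (Fin n), J.card < k →
      (leftNbhd n E J).card + 1 ≠ J.card ∧ (rightNbhd n E J).card + 1 ≠ J.card

/-- Membership in `L_k^n`: the bipartite representation of `E` admits a maximum
matching of size `n - k` that decomposes the digraph into disjoint cycles and
isolated vertices. -/
def memL (n k : ℕ) (E : Finset (Fin n × Fin n)) : Prop :=
  ∃ M, IsMaxMatching n E M ∧ M.card = n - k ∧ CyclesAndIsolated n M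

/-- The probability, under the random digraph model `G(n, p, q)` (each non-loop
edge present independently with probability `p`, each self-loop with
probability `q`), that the sampled digraph lies in the set `A`. -/
noncomputable def digraphProb (n : ℕ) (p q : ℝ)
    (A : Set (Finset (Fin n × Fin n))) : ℝ :=
  ∑ E : Finset (Fin n × Fin n),
    Set.indicator A (fun E =>
      (∏ e ∈ E, if e.1 = e.2 then q else p) *
      ∏ e ∈ Finset.univ \ E, if e.1 = e.2 then 1 - q else 1 - p) E

section RandomSubset

variable {ι : Type*} [Fintype ι] [DecidableEq ι]

/-- The probability that the random subset of `ι` containing each `e` independently with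
probability `r e` equals `E`. -/
noncomputable def subsetWeight (r : ι → ℝ) (E : Finset ι) : ℝ :=
  ∏ e, if e ∈ E then r e else 1 - r e

/-- The probability that the random subset of `ι` containing each `e` independently with
probability `r e` lies in `A`. -/
noncomputable def subsetProb (r : ι → ℝ) (A : Set (Finset ι)) : ℝ :=
  ∑ E, A.indicator (subsetWeight r) E

variable {r : ι → ℝ}

lemma subsetWeight_eq (r : ι → ℝ) (E : Finset ι) :
    subsetWeight r E = (∏ e ∈ E, r e) * ∏ e ∈ univ \ E, (1 - r e) := by
  unfold subsetWeight
  rw [Finset.prod_ite]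
  congr 2 <;> ext <;> simp

lemma subsetWeight_nonneg (hr : ∀ e, r e ∈ Set.Icc (0 : ℝ) 1) (E : Finset ι) :
    0 ≤ subsetWeight r E := by
  refine Finset.prod_nonneg fun e _ => ?_
  have := hr e
  split_ifs
  · exact this.1
  · linarith [this.2]

lemma subsetProb_univ (r : ι → ℝ) : subsetProb r Set.univ = 1 := by
  have h := Finset.prod_add r (fun e => 1 - r e) univ
  simp only [add_sub_cancel, Finset.prod_const_one, Finset.powerset_univ] at h
  simp only [subsetProb, Set.indicator_univ, subsetWeight_eq, ← h]

lemma subsetProb_nonneg (hr : ∀ e, r e ∈ Set.Icc (0 : ℝ) 1) (A : Set (Finset ι)) :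
    0 ≤ subsetProb r A :=
  Finset.sum_nonneg fun E _ => Set.indicator_nonneg (fun E _ => subsetWeight_nonneg hr E) E

lemma subsetProb_mono (hr : ∀ e, r e ∈ Set.Icc (0 : ℝ) 1) {A B : Set (Finset ι)} (h : A ⊆ B) :
    subsetProb r A ≤ subsetProb r B :=
  Finset.sum_le_sum fun E _ =>
    Set.indicator_le_indicator_of_subset h (fun E => subsetWeight_nonneg hr E) E

lemma subsetProb_union_le (hr : ∀ e, r e ∈ Set.Icc (0 : ℝ) 1) (A B : Set (Finset ι)) :
    subsetProb r (A ∪ B) ≤ subsetProb r A + subsetProb r B := by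
  unfold subsetProb
  rw [← Finset.sum_add_distrib]
  refine Finset.sum_le_sum fun E _ => ?_
  have := subsetWeight_nonneg hr E
  by_cases hA : E ∈ A <;> by_cases hB : E ∈ B <;> simp [hA, hB, this]

lemma subsetProb_union_of_disjoint {A B : Set (Finset ι)} (h : Disjoint A B) :
    subsetProb r (A ∪ B) = subsetProb r A + subsetProb r B := by
  unfold subsetProb
  rw [← Finset.sum_add_distrib, Set.indicator_union_of_disjoint h]

lemma subsetProb_compl (r : ι → ℝ) (A : Set (Finset ι)) :
    subsetProb r Aᶜ = 1 - subsetProb r A := by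
  have := subsetProb_union_of_disjoint (r := r) (disjoint_compl_right (a := A))
  rw [Set.union_compl_self, subsetProb_univ] at this
  linarith

lemma subsetProb_biUnion_le {κ : Type*} (hr : ∀ e, r e ∈ Set.Icc (0 : ℝ) 1) (s : Finset κ)
    (A : κ → Set (Finset ι)) :
    subsetProb r (⋃ i ∈ s, A i) ≤ ∑ i ∈ s, subsetProb r (A i) := by
  classical
  induction s using Finset.induction_on with
  | empty => simp [subsetProb]
  | insert a s ha ih =>
    rw [Finset.sum_insert ha, Finset.set_biUnion_insert]
    linarith [subsetProb_union_le hr (A a) (⋃ i ∈ s, A i)]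

lemma subsetProb_biUnion_of_disjoint {κ : Type*} (s : Finset κ)
    (A : κ → Set (Finset ι)) (hA : (s : Set κ).PairwiseDisjoint A) :
    subsetProb r (⋃ i ∈ s, A i) = ∑ i ∈ s, subsetProb r (A i) := by
  unfold subsetProb
  rw [Finset.sum_comm]
  refine Finset.sum_congr rfl fun E _ => ?_
  exact congrFun (Finset.indicator_biUnion s A hA (f := subsetWeight r)) E

/-- Conditioning on the random subset containing `S` and avoiding `Z`. -/
lemma subsetProb_inter_cylinder (r : ι → ℝ) {S Z : Finset ι} (hSZ : Disjoint S Z)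
    (A : Set (Finset ι)) :
    subsetProb r {E | S ⊆ E ∧ Disjoint E Z ∧ E ∈ A} =
      (∏ e ∈ S, r e) * (∏ e ∈ Z, (1 - r e)) *
        subsetProb (fun e => if e ∈ S then 1 else if e ∈ Z then 0 else r e) A := by
  unfold subsetProb
  rw [Finset.mul_sum]
  refine Finset.sum_congr rfl fun E _ => ?_
  by_cases hA : E ∈ A
  swap
  · simp [hA]
  have hS : ∏ e ∈ S, r e = ∏ e, if e ∈ S then r e else 1 := by simp
  have hZ : ∏ e ∈ Z, (1 - r e) = ∏ e, if e ∈ Z then 1 - r e else 1 := by simp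
  rw [Set.indicator_of_mem hA, hS, hZ]
  unfold subsetWeight
  rw [← Finset.prod_mul_distrib, ← Finset.prod_mul_distrib]
  by_cases h : S ⊆ E ∧ Disjoint E Z
  · rw [Set.indicator_of_mem (show E ∈ {E | S ⊆ E ∧ Disjoint E Z ∧ E ∈ A} from ⟨h.1, h.2, hA⟩)]
    refine Finset.prod_congr rfl fun e _ => ?_
    have h1 := @h.1 e
    have h2 := fun (h' : e ∈ E) => Finset.disjoint_left.1 h.2 h'
    by_cases hs : e ∈ S <;> by_cases hz : e ∈ Z <;> by_cases he : e ∈ E <;> simp_all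
  · rw [Set.indicator_of_notMem (fun hE => h ⟨hE.1, hE.2.1⟩)]
    symm
    rw [not_and_or] at h
    rcases h with h | h
    · obtain ⟨e, hs, he⟩ := Finset.not_subset.1 h
      exact Finset.prod_eq_zero (Finset.mem_univ e) (by simp [hs, he])
    · obtain ⟨e, he, hz⟩ := Finset.not_disjoint_iff.1 h
      have hs : e ∉ S := fun hs => Finset.disjoint_left.1 hSZ hs hz
      exact Finset.prod_eq_zero (Finset.mem_univ e) (by simp [hs, he, hz])

lemma subsetProb_cylinder (r : ι → ℝ) {S Z : Finset ι} (hSZ : Disjoint S Z) :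
    subsetProb r {E | S ⊆ E ∧ Disjoint E Z} = (∏ e ∈ S, r e) * ∏ e ∈ Z, (1 - r e) := by
  have := subsetProb_inter_cylinder r hSZ Set.univ
  simpa [subsetProb_univ] using this

lemma subsetProb_disjoint (r : ι → ℝ) (Z : Finset ι) :
    subsetProb r {E | Disjoint E Z} = ∏ e ∈ Z, (1 - r e) := by
  simpa using subsetProb_cylinder r (Finset.disjoint_empty_left Z)

lemma subsetProb_not_disjoint (r : ι → ℝ) (Z : Finset ι) :
    subsetProb r {E | ¬ Disjoint E Z} = 1 - ∏ e ∈ Z, (1 - r e) := by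
  rw [← subsetProb_disjoint, ← subsetProb_compl]
  rfl

/-- Harris' inequality: increasing events are positively correlated. -/
lemma subsetProb_mul_le_inter (hr : ∀ e, r e ∈ Set.Icc (0 : ℝ) 1) {A B : Set (Finset ι)}
    (hA : IsUpperSet A) (hB : IsUpperSet B) :
    subsetProb r A * subsetProb r B ≤ subsetProb r (A ∩ B) := by
  classical
  have key := fkg (A.indicator 1) (B.indicator 1) (subsetWeight r)
    (fun E => subsetWeight_nonneg hr E) (Set.indicator_nonneg fun _ _ => zero_le_one)
    (Set.indicator_nonneg fun _ _ => zero_le_one) ?_ ?_ ?_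
  · have hμ := subsetProb_univ r
    simp only [subsetProb, Set.indicator_univ] at hμ
    rw [hμ, one_mul] at key
    unfold subsetProb
    have hind (C : Set (Finset ι)) (E : Finset ι) :
        C.indicator (subsetWeight r) E = subsetWeight r E * C.indicator 1 E := by
      by_cases h : E ∈ C <;> simp [h]
    simpa only [hind, Set.inter_indicator_one, Pi.mul_apply] using key
  · intro E F hEF
    by_cases h : E ∈ A
    · simp [h, hA hEF h]
    · rw [Set.indicator_of_notMem h]
      exact Set.indicator_nonneg (fun _ _ => zero_le_one) F
  · intro E F hEF
    by_cases h : E ∈ B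
    · simp [h, hB hEF h]
    · rw [Set.indicator_of_notMem h]
      exact Set.indicator_nonneg (fun _ _ => zero_le_one) F
  · intro E F
    refine le_of_eq ?_
    unfold subsetWeight
    rw [← Finset.prod_mul_distrib, ← Finset.prod_mul_distrib]
    refine Finset.prod_congr rfl fun e _ => ?_
    by_cases hE : e ∈ E <;> by_cases hF : e ∈ F <;> simp [hE, hF, mul_comm]

lemma prod_subsetProb_le_biInter {κ : Type*} (hr : ∀ e, r e ∈ Set.Icc (0 : ℝ) 1)
    (s : Finset κ) (A : κ → Set (Finset ι)) (hA : ∀ i, IsUpperSet (A i)) :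
    ∏ i ∈ s, subsetProb r (A i) ≤ subsetProb r (⋂ i ∈ s, A i) := by
  classical
  induction s using Finset.induction_on with
  | empty => simp [subsetProb_univ]
  | insert a s ha ih =>
    rw [Finset.prod_insert ha, Finset.set_biInter_insert]
    refine (mul_le_mul_of_nonneg_left ih (subsetProb_nonneg hr _)).trans ?_
    exact subsetProb_mul_le_inter hr (hA a) (isUpperSet_iInter₂ fun i _ => hA i)

lemma subsetProb_comp_equiv {κ : Type*} [Fintype κ] [DecidableEq κ] (r : ι → ℝ) (g : κ ≃ ι)
    (A : Set (Finset κ)) :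
    subsetProb (r ∘ g) A = subsetProb r {E | E.map g.symm.toEmbedding ∈ A} := by
  unfold subsetProb
  refine Fintype.sum_equiv (Equiv.finsetCongr g) _ _ fun E => ?_
  have h1 : ((Equiv.finsetCongr g E).map g.symm.toEmbedding) = E := by
    ext; simp
  have h2 : subsetWeight (r ∘ g) E = subsetWeight r (Equiv.finsetCongr g E) := by
    unfold subsetWeight
    refine Fintype.prod_equiv g _ _ fun e => ?_
    simp
  by_cases h : E ∈ A
  · rw [Set.indicator_of_mem h, Set.indicator_of_mem (by simpa only [Set.mem_ofPred_eq, h1]), h2]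
  · rw [Set.indicator_of_notMem h, Set.indicator_of_notMem (by simpa only [Set.mem_ofPred_eq, h1])]

end RandomSubset

section HallObstruction

variable {α : Type*} [DecidableEq α] {R : α → α → Prop} {A B : Finset α}

/-- A minimal obstruction to Hall's condition: `k` vertices of `A` whose neighbours in `B` lie in a
set of `k - 1` vertices, each of which has at least two neighbours among the `k` vertices. -/
def HallObstruction (R : α → α → Prop) (A B : Finset α) (k : ℕ) : Prop :=
  ∃ I ⊆ A, ∃ N ⊆ B, #I = k ∧ #N + 1 = k ∧ (∀ a ∈ I, ∀ b ∈ B \ N, ¬ R a b) ∧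
    ∀ b ∈ N, ∃ a ∈ I, ∃ a' ∈ I, a ≠ a' ∧ R a b ∧ R a' b

/-- The bipartite graph `R` has a matching of `A` into `B`. -/
def HasMatchingInto (R : α → α → Prop) (A B : Finset α) : Prop :=
  ∃ f : α → α, Set.InjOn f A ∧ ∀ a ∈ A, f a ∈ B ∧ R a (f a)

open Classical in
lemma card_le_card_neighbors_add_one {I : Finset α} (hI : I ⊆ A)
    (hmin : ∀ J ⊆ A, #J < #I → #J ≤ #{b ∈ B | ∃ a ∈ J, R a b}) :
    #I ≤ #{b ∈ B | ∃ a ∈ I, R a b} + 1 := by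
  obtain rfl | ⟨a, ha⟩ := I.eq_empty_or_nonempty
  · simp
  have h1 := hmin (I.erase a) ((I.erase_subset a).trans hI) (Finset.card_erase_lt_of_mem ha)
  rw [Finset.card_erase_of_mem ha] at h1
  have h2 : #{b ∈ B | ∃ a' ∈ I.erase a, R a' b} ≤ #{b ∈ B | ∃ a ∈ I, R a b} :=
    Finset.card_le_card <| Finset.monotone_filter_right B
      fun b _ ⟨a', ha', h⟩ => ⟨a', Finset.mem_of_mem_erase ha', h⟩
  omega

open Classical in
lemma hallObstruction_of_minimal {I : Finset α} (hI : I ⊆ A)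
    (hdef : #{b ∈ B | ∃ a ∈ I, R a b} < #I)
    (hmin : ∀ J ⊆ A, #J < #I → #J ≤ #{b ∈ B | ∃ a ∈ J, R a b}) :
    HallObstruction R A B #I := by
  have herase : ∀ a ∈ I, #I ≤ #{b ∈ B | ∃ a' ∈ I.erase a, R a' b} + 1 := by
    intro a ha
    have := hmin (I.erase a) ((I.erase_subset a).trans hI) (Finset.card_erase_lt_of_mem ha)
    rw [Finset.card_erase_of_mem ha] at this
    omega
  refine ⟨I, hI, {b ∈ B | ∃ a ∈ I, R a b}, Finset.filter_subset _ _, rfl, ?_, ?_, ?_⟩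
  · have := card_le_card_neighbors_add_one hI hmin
    omega
  · intro a ha b hb hR
    rw [Finset.mem_sdiff, Finset.mem_filter] at hb
    exact hb.2 ⟨hb.1, a, ha, hR⟩
  · intro b hb
    have hb' := hb
    rw [Finset.mem_filter] at hb
    obtain ⟨hbB, a, ha, hR⟩ := hb
    by_contra! hcon
    have h1 := herase a ha
    have h2 : #{b ∈ B | ∃ a' ∈ I.erase a, R a' b} ≤ #({b ∈ B | ∃ a ∈ I, R a b}.erase b) := by
      refine Finset.card_le_card fun x hx => ?_
      rw [Finset.mem_filter] at hx
      obtain ⟨hxB, a', ha', hR'⟩ := hx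
      rw [Finset.mem_erase] at ha'
      rw [Finset.mem_erase, Finset.mem_filter]
      refine ⟨?_, hxB, a', ha'.2, hR'⟩
      rintro rfl
      exact hcon a ha a' ha'.2 ha'.1.symm hR hR'
    rw [Finset.card_erase_of_mem hb'] at h2
    have h3 := Finset.card_pos.2 ⟨b, hb'⟩
    omega

open Classical in
lemma card_neighbors_sdiff_lt (hAB : #A = #B) {I : Finset α} (hI : I ⊆ A)
    (hdef : #{b ∈ B | ∃ a ∈ I, R a b} < #I) :
    #{a ∈ A | ∃ b ∈ B \ {b ∈ B | ∃ a ∈ I, R a b}, R a b} <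
      #(B \ {b ∈ B | ∃ a ∈ I, R a b}) := by
  have h1 : #{a ∈ A | ∃ b ∈ B \ {b ∈ B | ∃ a ∈ I, R a b}, R a b} ≤ #(A \ I) := by
    refine Finset.card_le_card fun a ha => ?_
    rw [Finset.mem_filter] at ha
    obtain ⟨haA, b, hb, hR⟩ := ha
    rw [Finset.mem_sdiff, Finset.mem_filter] at hb
    exact Finset.mem_sdiff.2 ⟨haA, fun haI => hb.2 ⟨hb.1, a, haI, hR⟩⟩
  rw [Finset.card_sdiff_of_subset hI] at h1
  rw [Finset.card_sdiff_of_subset (Finset.filter_subset _ _)]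
  have := Finset.card_le_card hI
  omega

lemma HallObstruction.two_le {k : ℕ} (h : HallObstruction R A B k)
    (hA : ∀ a ∈ A, ∃ b ∈ B, R a b) : 2 ≤ k := by
  obtain ⟨I, hI, N, -, hk, hN, hR, -⟩ := h
  by_contra hlt
  have hN0 : N = ∅ := Finset.card_eq_zero.1 (by omega)
  obtain ⟨a, ha⟩ : I.Nonempty := by rw [← Finset.card_pos]; omega
  obtain ⟨b, hb, hab⟩ := hA a (hI ha)
  exact hR a ha b (by simpa [hN0]) hab

open Classical in
/-- A quantitative form of Hall's theorem in a balanced bipartite graph without isolated vertices: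
a graph with no perfect matching has a small minimal obstruction on one of its two sides. -/
theorem hasMatchingInto_or_hallObstruction (hAB : #A = #B)
    (hA : ∀ a ∈ A, ∃ b ∈ B, R a b) (hB : ∀ b ∈ B, ∃ a ∈ A, R a b) :
    HasMatchingInto R A B ∨ ∃ k ∈ Finset.Icc 2 ((#A + 1) / 2),
      HallObstruction R A B k ∨ HallObstruction (fun b a => R a b) B A k := by
  by_cases hall : ∀ I ⊆ A, #I ≤ #{b ∈ B | ∃ a ∈ I, R a b}
  · left
    obtain ⟨f, hf, hft⟩ := (Finset.all_card_le_biUnion_card_iff_exists_injective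
      (fun a : A => {b ∈ B | R a b})).1 fun s => by
        have h := hall (s.map (Function.Embedding.subtype _)) fun a ha => by
          simp only [Finset.mem_map] at ha
          obtain ⟨x, -, rfl⟩ := ha
          exact x.2
        rw [Finset.card_map] at h
        refine h.trans (Finset.card_le_card fun b hb => ?_)
        simp only [Finset.mem_filter, Finset.mem_map] at hb
        obtain ⟨hbB, _, ⟨x, hx, rfl⟩, hR⟩ := hb
        simp only [Finset.mem_biUnion, Finset.mem_filter]
        exact ⟨x, hx, hbB, hR⟩
    refine ⟨fun a => if h : a ∈ A then f ⟨a, h⟩ else a, ?_, ?_⟩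
    · intro a ha a' ha' h
      have ha : a ∈ A := ha
      have ha' : a' ∈ A := ha'
      simp only [ha, ha', dif_pos] at h
      exact congrArg Subtype.val (hf h)
    · intro a ha
      simp only [ha, dif_pos]
      exact Finset.mem_filter.1 (hft ⟨a, ha⟩)
  · right
    push Not at hall
    let P : ℕ → Prop := fun k => (∃ I ⊆ A, #I = k ∧ #{b ∈ B | ∃ a ∈ I, R a b} < #I) ∨
      ∃ J ⊆ B, #J = k ∧ #{a ∈ A | ∃ b ∈ J, R a b} < #J
    have hP : ∃ k, P k := by
      obtain ⟨I, hI, hlt⟩ := hall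
      exact ⟨#I, Or.inl ⟨I, hI, rfl, hlt⟩⟩
    have hmin : ∀ j, j < Nat.find hP → ¬ P j := fun j hj => Nat.find_min hP hj
    have hminL : ∀ J ⊆ A, #J < Nat.find hP → #J ≤ #{b ∈ B | ∃ a ∈ J, R a b} := by
      intro J hJ hlt
      by_contra! h
      exact hmin _ hlt (Or.inl ⟨J, hJ, rfl, h⟩)
    have hminR : ∀ J ⊆ B, #J < Nat.find hP → #J ≤ #{a ∈ A | ∃ b ∈ J, R a b} := by
      intro J hJ hlt
      by_contra! h
      exact hmin _ hlt (Or.inr ⟨J, hJ, rfl, h⟩)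
    have hle : ∀ {k}, P k → Nat.find hP ≤ k := fun h => Nat.find_min' hP h
    rcases Nat.find_spec hP with ⟨I, hI, hk, hlt⟩ | ⟨I, hI, hk, hlt⟩
    · rw [← hk] at hle hminL
      have hobs := hallObstruction_of_minimal hI hlt hminL
      have h1 := hle (Or.inr ⟨_, Finset.sdiff_subset, rfl,
        card_neighbors_sdiff_lt hAB hI hlt⟩)
      rw [Finset.card_sdiff_of_subset (Finset.filter_subset _ _)] at h1
      have h2 := card_le_card_neighbors_add_one hI hminL
      refine ⟨#I, Finset.mem_Icc.2 ⟨hobs.two_le hA, ?_⟩, Or.inl hobs⟩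
      omega
    · rw [← hk] at hle hminR
      have hobs := hallObstruction_of_minimal hI hlt hminR
      have h1 := hle (Or.inl ⟨_, Finset.sdiff_subset, rfl,
        card_neighbors_sdiff_lt hAB.symm hI hlt⟩)
      rw [Finset.card_sdiff_of_subset (Finset.filter_subset _ _)] at h1
      have h2 := card_le_card_neighbors_add_one hI hminR
      refine ⟨#I, Finset.mem_Icc.2 ⟨hobs.two_le hB, ?_⟩, Or.inr hobs⟩
      omega

end HallObstruction

section ObstructionProbability

/-- An exponential Markov bound for elementary symmetric sums. -/
lemma sum_powersetCard_prod_le {κ : Type*} (s : Finset κ) {w : κ → ℝ} (hw : ∀ i, 0 ≤ w i)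
    {t : ℝ} (ht : 0 < t) (j : ℕ) :
    ∑ N ∈ s.powersetCard j, ∏ i ∈ N, w i ≤ (t ^ j)⁻¹ * Real.exp (t * ∑ i ∈ s, w i) := by
  rw [le_inv_mul_iff₀ (by positivity), Finset.mul_sum]
  calc ∑ N ∈ s.powersetCard j, t ^ j * ∏ i ∈ N, w i
      = ∑ N ∈ s.powersetCard j, ∏ i ∈ N, t * w i := by
        refine Finset.sum_congr rfl fun N hN => ?_
        rw [Finset.prod_mul_distrib, Finset.prod_const, (Finset.mem_powersetCard.1 hN).2]
    _ ≤ ∑ N ∈ s.powerset, ∏ i ∈ N, t * w i :=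
        Finset.sum_le_sum_of_subset_of_nonneg
          (fun N hN => Finset.mem_powerset.2 (Finset.mem_powersetCard.1 hN).1)
          fun N _ _ => Finset.prod_nonneg fun i _ => mul_nonneg ht.le (hw i)
    _ = ∏ i ∈ s, (1 + t * w i) := (Finset.prod_one_add s).symm
    _ ≤ ∏ i ∈ s, Real.exp (t * w i) := by
        refine Finset.prod_le_prod (fun i _ => ?_) fun i _ => ?_
        · have := mul_nonneg ht.le (hw i)
          linarith
        · linarith [Real.add_one_le_exp (t * w i)]
    _ = Real.exp (t * ∑ i ∈ s, w i) := by rw [← Real.exp_sum, Finset.mul_sum]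

variable {α : Type*} [DecidableEq α] {r : α × α → ℝ} {p : ℝ} {A B : Finset α}

lemma prod_one_sub_product_le (hr : ∀ e, r e ∈ Set.Icc (0 : ℝ) 1) (hp : p ∈ Set.Icc (0 : ℝ) 1)
    {I J : Finset α} (hIJ : ∀ a ∈ I, ∀ b ∈ J, a ≠ b → r (a, b) = p) :
    ∏ e ∈ I ×ˢ J, (1 - r e) ≤ (1 - p) ^ (#I * (#J - 1)) := by
  have hnn : ∀ e, 0 ≤ 1 - r e := fun e => sub_nonneg.2 (hr e).2
  rw [Finset.prod_product, mul_comm, pow_mul, ← Finset.prod_const]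
  refine Finset.prod_le_prod (fun a _ => Finset.prod_nonneg fun b _ => hnn _) fun a ha => ?_
  calc ∏ b ∈ J, (1 - r (a, b)) ≤ ∏ b ∈ J.erase a, (1 - r (a, b)) := by
        by_cases haJ : a ∈ J
        · rw [← Finset.mul_prod_erase J _ haJ]
          exact mul_le_of_le_one_left (Finset.prod_nonneg fun b _ => hnn _)
            (by linarith [(hr (a, a)).1])
        · rw [Finset.erase_eq_of_notMem haJ]
    _ = ∏ b ∈ J.erase a, (1 - p) := by
        refine Finset.prod_congr rfl fun b hb => ?_
        rw [Finset.mem_erase] at hb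
        rw [hIJ a ha b hb.2 hb.1.symm]
    _ = (1 - p) ^ #(J.erase a) := Finset.prod_const _
    _ ≤ (1 - p) ^ (#J - 1) :=
        pow_le_pow_of_le_one (sub_nonneg.2 hp.2) (by linarith [hp.1])
          Finset.pred_card_le_card_erase

/-- Ordered pairs of distinct elements of `I` whose second entry is not `b`. -/
def distinctPairs (I : Finset α) (b : α) : Finset (α × α) :=
  {x ∈ I ×ˢ I | x.1 ≠ x.2 ∧ x.2 ≠ b}

variable [Fintype α]

lemma sum_distinctPairs_le (hr : ∀ e, r e ∈ Set.Icc (0 : ℝ) 1) (hp : 0 ≤ p)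
    (hoff : ∀ a b, a ≠ b → r (a, b) ≤ p) (I : Finset α) :
    ∑ b ∈ B, ∑ x ∈ distinctPairs I b, r (x.1, b) * r (x.2, b) ≤
      (#I : ℝ) ^ 2 * p * (1 + Fintype.card α * p) := by
  have h1 : ∀ b ∈ B, ∑ x ∈ distinctPairs I b, r (x.1, b) * r (x.2, b) ≤
      (#I * p) * ∑ a ∈ I, r (a, b) := by
    intro b _
    calc ∑ x ∈ distinctPairs I b, r (x.1, b) * r (x.2, b)
        ≤ ∑ x ∈ distinctPairs I b, r (x.1, b) * p := by
          refine Finset.sum_le_sum fun x hx => ?_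
          simp only [distinctPairs, Finset.mem_filter] at hx
          exact mul_le_mul_of_nonneg_left (hoff _ _ hx.2.2) (hr _).1
      _ ≤ ∑ x ∈ I ×ˢ I, r (x.1, b) * p :=
          Finset.sum_le_sum_of_subset_of_nonneg (Finset.filter_subset _ _)
            fun x _ _ => mul_nonneg (hr _).1 hp
      _ = (#I * p) * ∑ a ∈ I, r (a, b) := by
          rw [Finset.sum_product, Finset.mul_sum]
          refine Finset.sum_congr rfl fun a _ => ?_
          simp only [Finset.sum_const, nsmul_eq_mul]
          ring
  have h2 : ∀ a ∈ I, ∑ b ∈ B, r (a, b) ≤ 1 + Fintype.card α * p := by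
    intro a _
    calc ∑ b ∈ B, r (a, b) ≤ ∑ b, r (a, b) :=
          Finset.sum_le_sum_of_subset_of_nonneg (Finset.subset_univ _) fun b _ _ => (hr _).1
      _ ≤ ∑ b, ((if a = b then 1 else 0) + p) := by
          refine Finset.sum_le_sum fun b _ => ?_
          split_ifs with h
          · linarith [(hr (a, b)).2]
          · linarith [hoff a b h]
      _ = 1 + Fintype.card α * p := by
          simp [Finset.sum_add_distrib]
  calc ∑ b ∈ B, ∑ x ∈ distinctPairs I b, r (x.1, b) * r (x.2, b)
      ≤ ∑ b ∈ B, (#I * p) * ∑ a ∈ I, r (a, b) := Finset.sum_le_sum h1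
    _ = (#I * p) * ∑ a ∈ I, ∑ b ∈ B, r (a, b) := by rw [← Finset.mul_sum, Finset.sum_comm]
    _ ≤ (#I * p) * ∑ a ∈ I, (1 + Fintype.card α * p) :=
        mul_le_mul_of_nonneg_left (Finset.sum_le_sum h2) (by positivity)
    _ = _ := by rw [Finset.sum_const, nsmul_eq_mul]; ring

/-- The probability that fixed sets `I`, `N` form a minimal obstruction. -/
lemma subsetProb_obstruction_at_le (hr : ∀ e, r e ∈ Set.Icc (0 : ℝ) 1)
    (hp : p ∈ Set.Icc (0 : ℝ) 1) {I J N : Finset α} (hJN : Disjoint J N)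
    (hIJ : ∀ a ∈ I, ∀ b ∈ J, a ≠ b → r (a, b) = p) :
    subsetProb r {E | (∀ a ∈ I, ∀ b ∈ J, (a, b) ∉ E) ∧
      ∀ b ∈ N, ∃ a ∈ I, ∃ a' ∈ I, a ≠ a' ∧ (a, b) ∈ E ∧ (a', b) ∈ E} ≤
    (1 - p) ^ (#I * (#J - 1)) *
      ∏ b ∈ N, ∑ x ∈ distinctPairs I b, r (x.1, b) * r (x.2, b) := by
  rw [Finset.prod_sum, Finset.mul_sum]
  let S (φ : ∀ b ∈ N, α × α) : Finset (α × α) :=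
    N.attach.biUnion fun b => {((φ b.1 b.2).1, b.1), ((φ b.1 b.2).2, b.1)}
  refine (subsetProb_mono hr (B := ⋃ φ ∈ N.pi (distinctPairs I),
    {E | S φ ⊆ E ∧ Disjoint E (I ×ˢ J)}) ?_).trans
    ((subsetProb_biUnion_le hr _ _).trans (Finset.sum_le_sum fun φ hφ => ?_))
  · rintro E ⟨hE, hN⟩
    have : ∀ b ∈ N, ∃ x ∈ distinctPairs I b, (x.1, b) ∈ E ∧ (x.2, b) ∈ E := by
      intro b hb
      obtain ⟨a, ha, a', ha', hne, h, h'⟩ := hN b hb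
      by_cases hab : a' = b
      · refine ⟨(a', a), ?_, h', h⟩
        simp only [distinctPairs, Finset.mem_filter, Finset.mem_product]
        exact ⟨⟨ha', ha⟩, hne.symm, fun h => hne (h.trans hab.symm)⟩
      · refine ⟨(a, a'), ?_, h, h'⟩
        simp only [distinctPairs, Finset.mem_filter, Finset.mem_product]
        exact ⟨⟨ha, ha'⟩, hne, hab⟩
    choose φ hφ hφE using this
    simp only [Set.mem_iUnion]
    refine ⟨φ, Finset.mem_pi.2 hφ, ?_, ?_⟩
    · intro e he
      simp only [S, Finset.mem_biUnion, Finset.mem_insert, Finset.mem_singleton] at he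
      obtain ⟨b, -, rfl | rfl⟩ := he
      · exact (hφE b.1 b.2).1
      · exact (hφE b.1 b.2).2
    · rw [Finset.disjoint_left]
      rintro ⟨a, b⟩ he hIJ
      rw [Finset.mem_product] at hIJ
      exact hE a hIJ.1 b hIJ.2 he
  · have hdisj : Disjoint (S φ) (I ×ˢ J) := by
      rw [Finset.disjoint_left]
      intro e he heIJ
      rw [Finset.mem_product] at heIJ
      simp only [S, Finset.mem_biUnion, Finset.mem_insert, Finset.mem_singleton] at he
      obtain ⟨b, -, rfl | rfl⟩ := he <;> exact Finset.disjoint_left.1 hJN heIJ.2 b.2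
    rw [subsetProb_cylinder r hdisj, mul_comm]
    refine mul_le_mul (prod_one_sub_product_le hr hp hIJ) (le_of_eq ?_)
      (Finset.prod_nonneg fun e _ => (hr e).1) (pow_nonneg (sub_nonneg.2 hp.2) _)
    rw [Finset.prod_biUnion]
    · refine Finset.prod_congr rfl fun b _ => ?_
      have := Finset.mem_pi.1 hφ b.1 b.2
      simp only [distinctPairs, Finset.mem_filter] at this
      rw [Finset.prod_pair]
      intro h
      exact this.2.1 (Prod.ext_iff.1 h).1
    · intro b _ b' _ hne
      rw [Function.onFun, Finset.disjoint_left]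
      intro e he he'
      simp only [Finset.mem_insert, Finset.mem_singleton] at he he'
      apply hne
      ext
      rcases he with rfl | rfl <;> rcases he' with h | h <;> exact (Prod.ext_iff.1 h).2

lemma subsetProb_hallObstruction_le (hr : ∀ e, r e ∈ Set.Icc (0 : ℝ) 1)
    (hp0 : 0 < p) (hp1 : p ≤ 1) (hoff : ∀ a b, a ≠ b → r (a, b) ≤ p)
    (hAB : ∀ a ∈ A, ∀ b ∈ B, a ≠ b → r (a, b) = p) (hB : #B + 1 = Fintype.card α)
    {k : ℕ} (hk : 1 ≤ k) :
    subsetProb r {E | HallObstruction (fun a b => (a, b) ∈ E) A B k} ≤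
      Fintype.card α * ((1 + Fintype.card α * p) ^ 2 * Real.exp 2) ^ k *
        (1 - p) ^ (k * (Fintype.card α - k - 1)) := by
  set n := Fintype.card α with hn
  have hn0 : 0 < n := by omega
  have hk0 : (0 : ℝ) < k := by exact_mod_cast hk
  have hn0' : (0 : ℝ) < n := by exact_mod_cast hn0
  set W : ℝ := (k : ℝ) ^ 2 * p * (1 + n * p) with hW
  have hW0 : 0 < W := by positivity
  set Q : ℝ := (1 - p) ^ (k * (n - k - 1)) with hQ
  have hQ0 : 0 ≤ Q := pow_nonneg (sub_nonneg.2 hp1) _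
  have hstep : ∀ I ∈ A.powersetCard k,
      ∑ N ∈ B.powersetCard (k - 1), Q *
        ∏ b ∈ N, ∑ x ∈ distinctPairs I b, r (x.1, b) * r (x.2, b) ≤
      Q * (((k / W) ^ (k - 1))⁻¹ * Real.exp k) := by
    intro I hI
    rw [← Finset.mul_sum]
    refine mul_le_mul_of_nonneg_left ?_ hQ0
    refine (sum_powersetCard_prod_le B (w := fun b => ∑ x ∈ distinctPairs I b,
      r (x.1, b) * r (x.2, b)) (fun b => Finset.sum_nonneg fun x _ =>
        mul_nonneg (hr _).1 (hr _).1) (div_pos hk0 hW0) _).trans ?_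
    refine mul_le_mul_of_nonneg_left (Real.exp_le_exp.2 ?_) (by positivity)
    have := sum_distinctPairs_le (B := B) hr hp0.le hoff I
    rw [(Finset.mem_powersetCard.1 hI).2, ← hn, ← hW] at this
    calc k / W * _ ≤ k / W * W := mul_le_mul_of_nonneg_left this (by positivity)
      _ = k := by field_simp
  calc subsetProb r {E | HallObstruction (fun a b => (a, b) ∈ E) A B k}
      ≤ subsetProb r (⋃ I ∈ A.powersetCard k, ⋃ N ∈ B.powersetCard (k - 1),
          {E | (∀ a ∈ I, ∀ b ∈ B \ N, (a, b) ∉ E) ∧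
            ∀ b ∈ N, ∃ a ∈ I, ∃ a' ∈ I, a ≠ a' ∧ (a, b) ∈ E ∧ (a', b) ∈ E}) := by
        refine subsetProb_mono hr ?_
        rintro E ⟨I, hI, N, hN, hIk, hNk, h1, h2⟩
        simp only [Set.mem_iUnion]
        exact ⟨I, Finset.mem_powersetCard.2 ⟨hI, hIk⟩, N,
          Finset.mem_powersetCard.2 ⟨hN, by omega⟩, h1, h2⟩
    _ ≤ ∑ I ∈ A.powersetCard k, ∑ N ∈ B.powersetCard (k - 1), Q *
          ∏ b ∈ N, ∑ x ∈ distinctPairs I b, r (x.1, b) * r (x.2, b) := by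
        refine (subsetProb_biUnion_le hr _ _).trans (Finset.sum_le_sum fun I hI => ?_)
        refine (subsetProb_biUnion_le hr _ _).trans (Finset.sum_le_sum fun N hN => ?_)
        rw [Finset.mem_powersetCard] at hI hN
        refine (subsetProb_obstruction_at_le hr ⟨hp0.le, hp1⟩ Finset.sdiff_disjoint
          fun a ha b hb => hAB a (hI.1 ha) b (Finset.sdiff_subset hb)).trans_eq ?_
        rw [Finset.card_sdiff_of_subset hN.1, hI.2, hN.2, hQ,
          show #B - (k - 1) - 1 = n - k - 1 by omega]
    _ ≤ ∑ I ∈ A.powersetCard k, Q * (((k / W) ^ (k - 1))⁻¹ * Real.exp k) :=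
        Finset.sum_le_sum hstep
    _ = (∑ I ∈ A.powersetCard k, ∏ i ∈ I, (1 : ℝ)) *
          (Q * (((k / W) ^ (k - 1))⁻¹ * Real.exp k)) := by simp
    _ ≤ (((k / n : ℝ) ^ k)⁻¹ * Real.exp k) *
          (Q * (((k / W) ^ (k - 1))⁻¹ * Real.exp k)) := by
        refine mul_le_mul_of_nonneg_right ?_ (by positivity)
        refine (sum_powersetCard_prod_le A (w := fun _ => 1) (fun _ => zero_le_one)
          (div_pos hk0 hn0') k).trans ?_
        refine mul_le_mul_of_nonneg_left (Real.exp_le_exp.2 ?_) (by positivity)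
        have : (#A : ℝ) ≤ n := by exact_mod_cast Finset.card_le_univ A
        calc (k / n : ℝ) * ∑ _i ∈ A, 1 = k / n * #A := by simp
          _ ≤ k / n * n := mul_le_mul_of_nonneg_left this (by positivity)
          _ = k := by field_simp
    _ = (((k / n : ℝ) ^ k)⁻¹ * ((k / W) ^ (k - 1))⁻¹) * Real.exp 2 ^ k * Q := by
        rw [← Real.exp_nat_mul, mul_comm (k : ℝ) 2, two_mul, Real.exp_add]
        ring
    _ ≤ (n * ((1 + n * p) ^ 2) ^ k) * Real.exp 2 ^ k * Q := by
        refine mul_le_mul_of_nonneg_right (mul_le_mul_of_nonneg_right ?_ (by positivity)) hQ0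
        obtain ⟨j, rfl⟩ : ∃ j, k = j + 1 := ⟨k - 1, by omega⟩
        set m : ℝ := ((j + 1 : ℕ) : ℝ)
        have hm1 : 1 ≤ m := by simp [m]
        have h1 : ((m / n : ℝ) ^ (j + 1))⁻¹ * ((m / W) ^ (j + 1 - 1))⁻¹ =
            n / m * (n * p * (1 + n * p)) ^ j := by
          rw [hW, Nat.add_sub_cancel, pow_succ, mul_inv, mul_right_comm, ← mul_inv, ← mul_pow,
            mul_comm, inv_div, ← inv_pow]
          congr 2
          field_simp
        rw [h1]
        refine mul_le_mul (div_le_self hn0'.le hm1) ?_ (by positivity) hn0'.le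
        have h2 : 0 ≤ n * p := by positivity
        calc (n * p * (1 + n * p)) ^ j ≤ ((1 + n * p) ^ 2) ^ j :=
              pow_le_pow_left₀ (by positivity) (by nlinarith) j
          _ ≤ ((1 + n * p) ^ 2) ^ (j + 1) :=
              pow_le_pow_right₀ (by nlinarith) (Nat.le_succ j)
    _ = _ := by rw [mul_pow]; ring

end ObstructionProbability

section SingleIsolatedPair

variable {n : ℕ} {p q : ℝ} {u v : Fin n}

/-- Edge probabilities of the random digraph model `G(n, p, q)`. -/
def edgeProb (n : ℕ) (p q : ℝ) (e : Fin n × Fin n) : ℝ :=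
  if e.1 = e.2 then q else p

/-- The edges of `B(G)` at the left vertex `u` or at the right vertex `v`. -/
def crossEdges (u v : Fin n) : Finset (Fin n × Fin n) :=
  {u} ×ˢ univ ∪ {u}ᶜ ×ˢ {v}

/-- Digraphs whose bipartite representation has `u` as an isolated left vertex, `v` as an isolated
right vertex, and a perfect matching between the remaining vertices. -/
def singleIsolatedPair (u v : Fin n) : Set (Finset (Fin n × Fin n)) :=
  {E | Disjoint E (crossEdges u v) ∧ HasMatchingInto (fun a b => (a, b) ∈ E) {u}ᶜ {v}ᶜ}

/-- The edge probabilities conditioned on `u` and `v` being isolated. -/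
def prunedProb (p q : ℝ) (u v : Fin n) (e : Fin n × Fin n) : ℝ :=
  if e ∈ crossEdges u v then 0 else edgeProb n p q e

lemma digraphProb_eq_subsetProb (n : ℕ) (p q : ℝ) (A : Set (Finset (Fin n × Fin n))) :
    digraphProb n p q A = subsetProb (edgeProb n p q) A := by
  unfold digraphProb subsetProb
  refine Finset.sum_congr rfl fun E _ => ?_
  refine congrFun (congrArg A.indicator (funext fun E => ?_)) E
  rw [subsetWeight_eq]
  congr 1
  refine Finset.prod_congr rfl fun e _ => ?_
  unfold edgeProb
  split_ifs <;> rfl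

lemma mem_crossEdges {a b : Fin n} : (a, b) ∈ crossEdges u v ↔ a = u ∨ b = v := by
  simp only [crossEdges, Finset.mem_union, Finset.mem_product, Finset.mem_singleton,
    Finset.mem_univ, Finset.mem_compl]
  tauto

lemma HasMatchingInto.exists_left {α : Type*} [DecidableEq α] {R : α → α → Prop} {A B : Finset α}
    (h : HasMatchingInto R A B) (hAB : #A = #B) : ∀ b ∈ B, ∃ a ∈ A, R a b := by
  obtain ⟨f, hf, hfR⟩ := h
  have himg : A.image f = B := by
    refine Finset.eq_of_subset_of_card_le ?_ ?_
    · intro b hb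
      obtain ⟨a, ha, rfl⟩ := Finset.mem_image.1 hb
      exact (hfR a ha).1
    · rw [Finset.card_image_of_injOn hf, hAB]
  intro b hb
  rw [← himg] at hb
  obtain ⟨a, ha, rfl⟩ := Finset.mem_image.1 hb
  exact ⟨a, ha, (hfR a ha).2⟩

lemma card_compl_singleton_fin (u : Fin n) : #({u}ᶜ : Finset (Fin n)) = n - 1 := by
  rw [Finset.card_compl, Finset.card_singleton, Fintype.card_fin]

lemma not_structurallyDiagonalizable_of_mem (huv : u ≠ v) {E : Finset (Fin n × Fin n)}
    (hE : E ∈ singleIsolatedPair u v) : ¬ StructurallyDiagonalizable n E := by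
  obtain ⟨hdis, f, hf, hfE⟩ := hE
  rintro ⟨_, ⟨hME, -, hmax⟩, σ, S, hS, rfl⟩
  have hcross : ∀ a b, (a, b) ∈ E → a ≠ u ∧ b ≠ v := by
    intro a b hab
    have := Finset.disjoint_left.1 hdis hab
    rwa [mem_crossEdges, not_or] at this
  have hedge : ∀ s ∈ S, (s, σ s) ∈ E := fun s hs => hME (Finset.mem_image_of_mem _ hs)
  have huS : u ∉ S := fun h => (hcross _ _ (hedge u h)).1 rfl
  have himg : S.image σ = S := by
    refine Finset.eq_of_subset_of_card_le ?_ ?_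
    · intro x hx
      obtain ⟨s, hs, rfl⟩ := Finset.mem_image.1 hx
      exact hS s hs
    · rw [Finset.card_image_of_injective _ σ.injective]
  have hvS : v ∉ S := by
    intro h
    rw [← himg] at h
    obtain ⟨s, hs, hsv⟩ := Finset.mem_image.1 h
    exact (hcross _ _ (hedge s hs)).2 hsv
  have h1 : #(({u}ᶜ : Finset (Fin n)).image fun a => (a, f a)) = n - 1 := by
    rw [Finset.card_image_of_injective _ fun a b h => (Prod.ext_iff.1 h).1,
      card_compl_singleton_fin]
  have h2 := hmax (({u}ᶜ : Finset (Fin n)).image fun a => (a, f a)) (by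
      intro e he
      obtain ⟨a, ha, rfl⟩ := Finset.mem_image.1 he
      exact (hfE a ha).2) (by
      intro e he e' he' h
      obtain ⟨a, ha, rfl⟩ := Finset.mem_image.1 he
      obtain ⟨a', ha', rfl⟩ := Finset.mem_image.1 he'
      rcases h with h | h
      · rw [show a = a' from h]
      · rw [show a = a' from hf ha ha' h])
  have h3 : #(S.image fun u => (u, σ u)) ≤ #S := Finset.card_image_le
  have h4 : #(insert u (insert v S)) ≤ n := by
    simpa using Finset.card_le_univ (insert u (insert v S))
  rw [Finset.card_insert_of_notMem (by simp [huv, huS]), Finset.card_insert_of_notMem hvS] at h4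
  omega

lemma pairwiseDisjoint_singleIsolatedPair :
    ((univ : Finset (Fin n)).offDiag : Set (Fin n × Fin n)).PairwiseDisjoint
      fun x => singleIsolatedPair x.1 x.2 := by
  rintro ⟨u, v⟩ - ⟨u', v'⟩ - hne
  rw [Function.onFun, Set.disjoint_left]
  rintro E ⟨hE, -⟩ ⟨-, hm⟩
  have hcross : ∀ a b, (a, b) ∈ E → a ≠ u ∧ b ≠ v := by
    intro a b hab
    have := Finset.disjoint_left.1 hE hab
    rwa [mem_crossEdges, not_or] at this
  apply hne
  ext1
  · by_contra hu
    obtain ⟨f, -, hf⟩ := hm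
    exact (hcross _ _ (hf u (by simpa using hu)).2).1 rfl
  · by_contra hv
    obtain ⟨a, -, ha⟩ :=
      hm.exists_left (by simp only [card_compl_singleton_fin]) v (by simpa using hv)
    exact (hcross _ _ ha).2 rfl

lemma edgeProb_mem_Icc (hp : p ∈ Set.Icc (0 : ℝ) 1) (hq : q ∈ Set.Icc (0 : ℝ) 1)
    (e : Fin n × Fin n) : edgeProb n p q e ∈ Set.Icc (0 : ℝ) 1 := by
  unfold edgeProb
  split_ifs <;> assumption

lemma prunedProb_mem_Icc (hp : p ∈ Set.Icc (0 : ℝ) 1) (hq : q ∈ Set.Icc (0 : ℝ) 1)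
    (e : Fin n × Fin n) : prunedProb p q u v e ∈ Set.Icc (0 : ℝ) 1 := by
  unfold prunedProb
  split_ifs
  · simp
  · exact edgeProb_mem_Icc hp hq e

lemma prunedProb_swap (p q : ℝ) (u v a b : Fin n) :
    prunedProb p q u v (a, b) = prunedProb p q v u (b, a) := by
  unfold prunedProb edgeProb
  simp only [mem_crossEdges, or_comm, eq_comm]

lemma prod_one_sub_edgeProb (p q : ℝ) (S : Finset (Fin n)) (a : Fin n) :
    ∏ b ∈ S, (1 - edgeProb n p q (a, b)) =
      if a ∈ S then (1 - q) * (1 - p) ^ (#S - 1) else (1 - p) ^ #S := by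
  have hoff : ∀ T : Finset (Fin n), a ∉ T →
      ∏ b ∈ T, (1 - edgeProb n p q (a, b)) = (1 - p) ^ #T := by
    intro T hT
    rw [← Finset.prod_const]
    refine Finset.prod_congr rfl fun b hb => ?_
    have : a ≠ b := fun h => hT (h ▸ hb)
    simp [edgeProb, this]
  split_ifs with h
  · rw [← Finset.mul_prod_erase S _ h, hoff _ (Finset.notMem_erase a S),
      Finset.card_erase_of_mem h]
    simp [edgeProb]
  · exact hoff S h

lemma edgeProb_swap (p q : ℝ) (a b : Fin n) : edgeProb n p q (a, b) = edgeProb n p q (b, a) := by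
  simp only [edgeProb, eq_comm]

lemma prod_crossEdges (p q : ℝ) (huv : u ≠ v) :
    ∏ e ∈ crossEdges u v, (1 - edgeProb n p q e) =
      (1 - q) ^ 2 * ((1 - p) ^ (n - 1) * (1 - p) ^ (n - 2)) := by
  have hdisj : Disjoint ({u} ×ˢ univ : Finset (Fin n × Fin n)) ({u}ᶜ ×ˢ {v}) := by
    rw [Finset.disjoint_left]
    rintro ⟨a, b⟩ h h'
    simp only [Finset.mem_product, Finset.mem_singleton, Finset.mem_compl] at h h'
    exact h'.1 h.1
  rw [crossEdges, Finset.prod_union hdisj, Finset.prod_product, Finset.prod_product,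
    Finset.prod_singleton]
  simp only [Finset.prod_singleton]
  simp only [edgeProb_swap p q _ v]
  rw [prod_one_sub_edgeProb, prod_one_sub_edgeProb, if_pos (Finset.mem_univ u),
    if_pos (by simpa using huv.symm), card_compl_singleton_fin, Finset.card_univ,
    Fintype.card_fin, show n - 1 - 1 = n - 2 by omega]
  ring

/-- The expected number of minimal obstructions of size `k` on one side is at most this. -/
noncomputable def obstructionBound (n : ℕ) (p : ℝ) (k : ℕ) : ℝ :=
  n * ((1 + n * p) ^ 2 * Real.exp 2) ^ k * (1 - p) ^ (k * (n - k - 1))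

/-- A lower bound for the probability that no vertex of a fixed side is isolated once `u` and `v`
have been removed. -/
noncomputable def noIsolatedBound (n : ℕ) (p q : ℝ) : ℝ :=
  (1 - (1 - p) ^ (n - 1)) * (1 - (1 - q) * (1 - p) ^ (n - 2)) ^ (n - 2)

lemma prod_row_prunedProb (huv : u ≠ v) (p q : ℝ) :
    ∏ a ∈ {u}ᶜ, (1 - ∏ b ∈ {v}ᶜ, (1 - prunedProb p q u v (a, b))) = noIsolatedBound n p q := by
  have h1 : ∀ a ∈ ({u}ᶜ : Finset (Fin n)), (1 - ∏ b ∈ {v}ᶜ, (1 - prunedProb p q u v (a, b))) =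
      if a = v then 1 - (1 - p) ^ (n - 1) else 1 - (1 - q) * (1 - p) ^ (n - 2) := by
    intro a ha
    have h2 : ∏ b ∈ {v}ᶜ, (1 - prunedProb p q u v (a, b)) =
        ∏ b ∈ {v}ᶜ, (1 - edgeProb n p q (a, b)) := by
      refine Finset.prod_congr rfl fun b hb => ?_
      rw [prunedProb, if_neg]
      rw [mem_crossEdges]
      simp only [Finset.mem_compl, Finset.mem_singleton] at ha hb
      tauto
    rw [h2, prod_one_sub_edgeProb, card_compl_singleton_fin, show n - 1 - 1 = n - 2 by omega]
    by_cases hav : a = v <;> simp [hav]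
  have hv : v ∈ ({u}ᶜ : Finset (Fin n)) := by simpa using huv.symm
  rw [Finset.prod_congr rfl h1, ← Finset.mul_prod_erase _ _ hv, if_pos rfl, noIsolatedBound]
  congr 1
  rw [Finset.prod_congr rfl fun a ha => if_neg (Finset.ne_of_mem_erase ha), Finset.prod_const,
    Finset.card_erase_of_mem hv, card_compl_singleton_fin, show n - 1 - 1 = n - 2 by omega]

lemma isUpperSet_not_disjoint {ι : Type*} [DecidableEq ι] (Z : Finset ι) :
    IsUpperSet {E : Finset ι | ¬ Disjoint E Z} :=
  fun _ _ hEF hE hF => hE (hF.mono_left hEF)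

lemma noIsolatedBound_nonneg (hp : p ∈ Set.Icc (0 : ℝ) 1) (hq : q ∈ Set.Icc (0 : ℝ) 1) :
    0 ≤ noIsolatedBound n p q := by
  have h1 : ∀ m, (1 - p) ^ m ≤ 1 := fun m =>
    pow_le_one₀ (sub_nonneg.2 hp.2) (by linarith [hp.1])
  have h2 : 0 ≤ (1 - p) ^ (n - 2) := pow_nonneg (sub_nonneg.2 hp.2) _
  refine mul_nonneg (sub_nonneg.2 (h1 _)) (pow_nonneg (sub_nonneg.2 ?_) _)
  nlinarith [h1 (n - 2), hq.1, hq.2]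

lemma noIsolatedBound_sq_le (huv : u ≠ v) (hp : p ∈ Set.Icc (0 : ℝ) 1)
    (hq : q ∈ Set.Icc (0 : ℝ) 1) :
    noIsolatedBound n p q ^ 2 ≤ subsetProb (prunedProb p q u v)
      ((⋂ a ∈ ({u}ᶜ : Finset (Fin n)), {E | ¬ Disjoint E ({a} ×ˢ {v}ᶜ)}) ∩
        ⋂ b ∈ ({v}ᶜ : Finset (Fin n)), {E | ¬ Disjoint E ({u}ᶜ ×ˢ {b})}) := by
  have hr : ∀ e, prunedProb p q u v e ∈ Set.Icc (0 : ℝ) 1 := prunedProb_mem_Icc hp hq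
  refine le_trans ?_ (subsetProb_mul_le_inter hr
    (isUpperSet_iInter₂ fun a _ => isUpperSet_not_disjoint _)
    (isUpperSet_iInter₂ fun b _ => isUpperSet_not_disjoint _))
  rw [sq]
  refine mul_le_mul ?_ ?_ (noIsolatedBound_nonneg hp hq) (subsetProb_nonneg hr _)
  · refine le_trans (le_of_eq ?_) (prod_subsetProb_le_biInter hr _ _
      fun a => isUpperSet_not_disjoint _)
    rw [← prod_row_prunedProb huv]
    refine Finset.prod_congr rfl fun a _ => ?_
    rw [subsetProb_not_disjoint, Finset.prod_product, Finset.prod_singleton]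
  · refine le_trans (le_of_eq ?_) (prod_subsetProb_le_biInter hr _ _
      fun a => isUpperSet_not_disjoint _)
    rw [← prod_row_prunedProb huv.symm]
    refine Finset.prod_congr rfl fun b _ => ?_
    rw [subsetProb_not_disjoint, Finset.prod_product]
    simp only [Finset.prod_singleton, prunedProb_swap p q v u]

lemma subsetProb_prunedProb_hallObstruction_le (hp0 : 0 < p) (hp1 : p ≤ 1)
    (hq : q ∈ Set.Icc (0 : ℝ) 1) {k : ℕ} (hk : 1 ≤ k) :
    subsetProb (prunedProb p q u v)
      {E | HallObstruction (fun a b => (a, b) ∈ E) {u}ᶜ {v}ᶜ k} ≤ obstructionBound n p k := by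
  have hn : 0 < n := u.pos
  have h := subsetProb_hallObstruction_le (r := prunedProb p q u v) (A := {u}ᶜ) (B := {v}ᶜ)
    (prunedProb_mem_Icc ⟨hp0.le, hp1⟩ hq) hp0 hp1 ?_ ?_ ?_ hk
  · rwa [Fintype.card_fin] at h
  · intro a b hab
    unfold prunedProb edgeProb
    split_ifs
    · exact hp0.le
    · exact le_rfl
  · intro a ha b hb hab
    simp only [Finset.mem_compl, Finset.mem_singleton] at ha hb
    rw [prunedProb, if_neg (by rw [mem_crossEdges]; tauto), edgeProb, if_neg hab]
  · rw [card_compl_singleton_fin, Fintype.card_fin]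
    omega

lemma subsetProb_prunedProb_hallObstruction_swap_le (hp0 : 0 < p) (hp1 : p ≤ 1)
    (hq : q ∈ Set.Icc (0 : ℝ) 1) {k : ℕ} (hk : 1 ≤ k) :
    subsetProb (prunedProb p q u v)
      {E | HallObstruction (fun b a => (a, b) ∈ E) {v}ᶜ {u}ᶜ k} ≤ obstructionBound n p k := by
  refine le_of_eq_of_le ?_
    (subsetProb_prunedProb_hallObstruction_le (u := v) (v := u) hp0 hp1 hq hk)
  rw [show prunedProb p q v u = prunedProb p q u v ∘ Equiv.prodComm _ _ from
    funext fun ⟨a, b⟩ => prunedProb_swap p q v u a b, subsetProb_comp_equiv]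
  congr 1
  ext E
  simp

lemma le_subsetProb_hasMatchingInto (huv : u ≠ v) (hp0 : 0 < p) (hp1 : p ≤ 1)
    (hq : q ∈ Set.Icc (0 : ℝ) 1) :
    noIsolatedBound n p q ^ 2 - 2 * ∑ k ∈ Finset.Icc 2 (n / 2), obstructionBound n p k ≤
      subsetProb (prunedProb p q u v)
        {E | HasMatchingInto (fun a b => (a, b) ∈ E) {u}ᶜ {v}ᶜ} := by
  have hr : ∀ e, prunedProb p q u v e ∈ Set.Icc (0 : ℝ) 1 := prunedProb_mem_Icc ⟨hp0.le, hp1⟩ hq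
  have hcover := subsetProb_mono hr (A := (⋂ a ∈ ({u}ᶜ : Finset (Fin n)),
      {E | ¬ Disjoint E ({a} ×ˢ {v}ᶜ)}) ∩ ⋂ b ∈ ({v}ᶜ : Finset (Fin n)),
        {E | ¬ Disjoint E ({u}ᶜ ×ˢ {b})})
    (B := {E | HasMatchingInto (fun a b => (a, b) ∈ E) {u}ᶜ {v}ᶜ} ∪
      ⋃ k ∈ Finset.Icc 2 (n / 2), ({E | HallObstruction (fun a b => (a, b) ∈ E) {u}ᶜ {v}ᶜ k} ∪
        {E | HallObstruction (fun b a => (a, b) ∈ E) {v}ᶜ {u}ᶜ k})) ?_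
  · have h1 := noIsolatedBound_sq_le huv ⟨hp0.le, hp1⟩ hq
    have h2 := subsetProb_union_le hr {E | HasMatchingInto (fun a b => (a, b) ∈ E) {u}ᶜ {v}ᶜ}
      (⋃ k ∈ Finset.Icc 2 (n / 2), ({E | HallObstruction (fun a b => (a, b) ∈ E) {u}ᶜ {v}ᶜ k} ∪
        {E | HallObstruction (fun b a => (a, b) ∈ E) {v}ᶜ {u}ᶜ k}))
    have h3 := subsetProb_biUnion_le hr (Finset.Icc 2 (n / 2)) fun k =>
      ({E | HallObstruction (fun a b => (a, b) ∈ E) {u}ᶜ {v}ᶜ k} ∪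
        {E | HallObstruction (fun b a => (a, b) ∈ E) {v}ᶜ {u}ᶜ k})
    have h4 : ∑ k ∈ Finset.Icc 2 (n / 2), subsetProb (prunedProb p q u v)
        ({E | HallObstruction (fun a b => (a, b) ∈ E) {u}ᶜ {v}ᶜ k} ∪
          {E | HallObstruction (fun b a => (a, b) ∈ E) {v}ᶜ {u}ᶜ k}) ≤
        2 * ∑ k ∈ Finset.Icc 2 (n / 2), obstructionBound n p k := by
      rw [Finset.mul_sum]
      refine Finset.sum_le_sum fun k hk => (subsetProb_union_le hr _ _).trans ?_
      have hk : 1 ≤ k := by linarith [(Finset.mem_Icc.1 hk).1]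
      rw [two_mul]
      exact add_le_add (subsetProb_prunedProb_hallObstruction_le hp0 hp1 hq hk)
        (subsetProb_prunedProb_hallObstruction_swap_le hp0 hp1 hq hk)
    linarith
  · rintro E ⟨hA, hB⟩
    simp only [Set.mem_iInter] at hA hB
    have hA' : ∀ a ∈ ({u}ᶜ : Finset (Fin n)), ∃ b ∈ ({v}ᶜ : Finset (Fin n)), (a, b) ∈ E := by
      intro a ha
      obtain ⟨⟨a', b⟩, he, hz⟩ := Finset.not_disjoint_iff.1 (hA a ha)
      rw [Finset.mem_product, Finset.mem_singleton] at hz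
      exact ⟨b, hz.2, hz.1 ▸ he⟩
    have hB' : ∀ b ∈ ({v}ᶜ : Finset (Fin n)), ∃ a ∈ ({u}ᶜ : Finset (Fin n)), (a, b) ∈ E := by
      intro b hb
      obtain ⟨⟨a, b'⟩, he, hz⟩ := Finset.not_disjoint_iff.1 (hB b hb)
      rw [Finset.mem_product, Finset.mem_singleton] at hz
      exact ⟨a, hz.1, hz.2 ▸ he⟩
    rcases hasMatchingInto_or_hallObstruction (R := fun a b => (a, b) ∈ E)
      (by simp only [card_compl_singleton_fin]) hA' hB' with h | ⟨k, hk, h⟩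
    · exact Or.inl h
    · right
      simp only [Set.mem_iUnion]
      rw [card_compl_singleton_fin, Nat.sub_add_cancel u.pos] at hk
      exact ⟨k, hk, h⟩

lemma subsetProb_singleIsolatedPair (huv : u ≠ v) (p q : ℝ) :
    subsetProb (edgeProb n p q) (singleIsolatedPair u v) =
      (1 - q) ^ 2 * ((1 - p) ^ (n - 1) * (1 - p) ^ (n - 2)) * subsetProb (prunedProb p q u v)
        {E | HasMatchingInto (fun a b => (a, b) ∈ E) {u}ᶜ {v}ᶜ} := by
  have h := subsetProb_inter_cylinder (edgeProb n p q)
    (Finset.disjoint_empty_left (crossEdges u v))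
    {E | HasMatchingInto (fun a b => (a, b) ∈ E) {u}ᶜ {v}ᶜ}
  rw [prod_crossEdges p q huv] at h
  simp only [Finset.empty_subset, true_and, Finset.prod_empty, one_mul, Finset.notMem_empty,
    if_false] at h
  exact h

/-- A lower bound for the probability that a random digraph is not structurally diagonalizable. -/
noncomputable def defectBound (n : ℕ) (p q : ℝ) : ℝ :=
  n * (n - 1) * ((1 - q) ^ 2 * ((1 - p) ^ (n - 1) * (1 - p) ^ (n - 2)) *
    (noIsolatedBound n p q ^ 2 - 2 * ∑ k ∈ Finset.Icc 2 (n / 2), obstructionBound n p k))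

theorem digraphProb_structurallyDiagonalizable_le (hp0 : 0 < p) (hp1 : p ≤ 1)
    (hq : q ∈ Set.Icc (0 : ℝ) 1) :
    digraphProb n p q {E | StructurallyDiagonalizable n E} ≤ 1 - defectBound n p q := by
  have hr : ∀ e, edgeProb n p q e ∈ Set.Icc (0 : ℝ) 1 := edgeProb_mem_Icc ⟨hp0.le, hp1⟩ hq
  have hcompl := subsetProb_compl (edgeProb n p q) {E | StructurallyDiagonalizable n E}
  have hsub := subsetProb_mono hr
    (A := ⋃ x ∈ (univ : Finset (Fin n)).offDiag, singleIsolatedPair x.1 x.2)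
    (B := {E | StructurallyDiagonalizable n E}ᶜ) (by
      refine Set.iUnion₂_subset fun x hx E hE => ?_
      exact not_structurallyDiagonalizable_of_mem (Finset.mem_offDiag.1 hx).2.2 hE)
  rw [subsetProb_biUnion_of_disjoint _ _ pairwiseDisjoint_singleIsolatedPair] at hsub
  have hle : defectBound n p q ≤ ∑ x ∈ (univ : Finset (Fin n)).offDiag,
      subsetProb (edgeProb n p q) (singleIsolatedPair x.1 x.2) := by
    have hcard : (#((univ : Finset (Fin n)).offDiag) : ℝ) = n * (n - 1) := by
      rw [Finset.offDiag_card, Finset.card_univ, Fintype.card_fin,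
        Nat.cast_sub (Nat.le_mul_self n)]
      push_cast
      ring
    rw [defectBound, ← hcard, ← nsmul_eq_mul]
    refine Finset.card_nsmul_le_sum _ _ _ fun x hx => ?_
    have hx := (Finset.mem_offDiag.1 hx).2.2
    rw [subsetProb_singleIsolatedPair hx]
    have : 0 ≤ 1 - p := sub_nonneg.2 hp1
    exact mul_le_mul_of_nonneg_left (le_subsetProb_hasMatchingInto hx hp0 hp1 hq) (by positivity)
  rw [digraphProb_eq_subsetProb]
  linarith

end SingleIsolatedPair

section Asymptotics

open Topology

variable {c : ℝ} {p : ℕ → ℝ}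

lemma tendsto_nat_mul_atTop
    (hlim : Tendsto (fun n : ℕ => (n : ℝ) * p n - Real.log n) atTop (𝓝 c)) :
    Tendsto (fun n : ℕ => (n : ℝ) * p n) atTop atTop := by
  have h := hlim.add_atTop (Real.tendsto_log_atTop.comp tendsto_natCast_atTop_atTop)
  refine h.congr fun n => ?_
  simp

lemma tendsto_nat_mul_sq_zero
    (hlim : Tendsto (fun n : ℕ => (n : ℝ) * p n - Real.log n) atTop (𝓝 c)) :
    Tendsto (fun n : ℕ => (n : ℝ) * p n ^ 2) atTop (𝓝 0) := by
  have hlog : ∀ j : ℕ, Tendsto (fun n : ℕ => Real.log n ^ j / (n : ℝ)) atTop (𝓝 0) := fun j =>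
    (Real.isLittleO_pow_log_id_atTop (n := j)).tendsto_div_nhds_zero.comp
      tendsto_natCast_atTop_atTop
  have h := (((hlim.pow 2).mul (hlog 0)).add ((hlim.const_mul 2).mul (hlog 1))).add (hlog 2)
  simp only [mul_zero, add_zero] at h
  refine h.congr' ?_
  filter_upwards [eventually_gt_atTop 0] with n hn
  have hn' : (n : ℝ) ≠ 0 := by positivity
  field_simp
  ring

lemma tendsto_zero_of_log_window
    (hlim : Tendsto (fun n : ℕ => (n : ℝ) * p n - Real.log n) atTop (𝓝 c)) :
    Tendsto p atTop (𝓝 0) := by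
  have h1 : Tendsto (fun n : ℕ => Real.log n / (n : ℝ)) atTop (𝓝 0) := by
    simpa [Function.comp_def] using
      (Real.isLittleO_pow_log_id_atTop (n := 1)).tendsto_div_nhds_zero.comp
        tendsto_natCast_atTop_atTop
  have h := (hlim.div_atTop tendsto_natCast_atTop_atTop).add h1
  rw [add_zero] at h
  refine h.congr' ?_
  filter_upwards [eventually_gt_atTop 0] with n hn
  have hn' : (n : ℝ) ≠ 0 := by positivity
  field_simp
  ring

lemma tendsto_nat_mul_one_sub_pow (hp : ∀ n, p n ∈ Set.Icc (0 : ℝ) 1)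
    (hlim : Tendsto (fun n : ℕ => (n : ℝ) * p n - Real.log n) atTop (𝓝 c)) :
    Tendsto (fun n : ℕ => (n : ℝ) * (1 - p n) ^ n) atTop (𝓝 (Real.exp (-c))) := by
  have hp2 : ∀ᶠ n in atTop, p n < 1 / 2 :=
    (tendsto_zero_of_log_window hlim).eventually_lt_const (by norm_num)
  have herr : Tendsto (fun n : ℕ => (n : ℝ) * (p n + Real.log (1 - p n))) atTop (𝓝 0) := by
    refine squeeze_zero_norm' ?_ (by simpa using (tendsto_nat_mul_sq_zero hlim).const_mul 2)
    filter_upwards [hp2] with n hn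
    have h0 := (hp n).1
    have h := Real.abs_log_sub_add_sum_range_le (x := p n) (by rw [abs_of_nonneg h0]; linarith) 1
    simp only [Finset.range_one, Finset.sum_singleton, zero_add, pow_one, Nat.cast_zero, div_one,
      abs_of_nonneg h0] at h
    rw [norm_mul, Real.norm_natCast, Real.norm_eq_abs, mul_left_comm]
    refine mul_le_mul_of_nonneg_left (h.trans ?_) (Nat.cast_nonneg n)
    rw [div_le_iff₀ (by linarith), one_add_one_eq_two]
    nlinarith [mul_nonneg (sq_nonneg (p n)) (by linarith : (0 : ℝ) ≤ 1 - 2 * p n)]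
  have h := (Real.continuous_exp.tendsto _).comp (hlim.neg.add herr)
  rw [add_zero] at h
  refine h.congr' ?_
  filter_upwards [hp2, eventually_gt_atTop 0] with n hn hn0
  have hn' : (0 : ℝ) < n := by exact_mod_cast hn0
  have h1 : 0 < 1 - p n := by linarith
  rw [Function.comp_apply, show -((n : ℝ) * p n - Real.log n) + n * (p n + Real.log (1 - p n)) =
    Real.log n + n * Real.log (1 - p n) by ring, Real.exp_add, Real.exp_log hn', Real.exp_nat_mul,
    Real.exp_log h1]

lemma tendsto_nat_mul_one_sub_pow_sub (hp : ∀ n, p n ∈ Set.Icc (0 : ℝ) 1)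
    (hlim : Tendsto (fun n : ℕ => (n : ℝ) * p n - Real.log n) atTop (𝓝 c)) (j : ℕ) :
    Tendsto (fun n : ℕ => (n : ℝ) * (1 - p n) ^ (n - j)) atTop (𝓝 (Real.exp (-c))) := by
  have hp0 := tendsto_zero_of_log_window hlim
  have h := (tendsto_nat_mul_one_sub_pow hp hlim).div ((hp0.const_sub 1).pow j) (by simp)
  simp only [sub_zero, one_pow, div_one] at h
  refine h.congr' ?_
  filter_upwards [eventually_ge_atTop j,
    hp0.eventually_lt_const (show (0 : ℝ) < 1 by norm_num)] with n hn hn1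
  have h1 : 1 - p n ≠ 0 := by linarith
  rw [Pi.div_apply, div_eq_iff (pow_ne_zero _ h1), mul_assoc, ← pow_add, Nat.sub_add_cancel hn]

lemma tendsto_one_sub_pow_sub (hp : ∀ n, p n ∈ Set.Icc (0 : ℝ) 1)
    (hlim : Tendsto (fun n : ℕ => (n : ℝ) * p n - Real.log n) atTop (𝓝 c)) (j : ℕ) :
    Tendsto (fun n : ℕ => (1 - p n) ^ (n - j)) atTop (𝓝 0) := by
  refine ((tendsto_nat_mul_one_sub_pow_sub hp hlim j).div_atTop
    tendsto_natCast_atTop_atTop).congr' ?_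
  filter_upwards [eventually_gt_atTop 0] with n hn
  have hn' : (n : ℝ) ≠ 0 := by positivity
  field_simp

lemma tendsto_noIsolatedBound (q : ℝ) (hp : ∀ n, p n ∈ Set.Icc (0 : ℝ) 1)
    (hlim : Tendsto (fun n : ℕ => (n : ℝ) * p n - Real.log n) atTop (𝓝 c)) :
    Tendsto (fun n : ℕ => noIsolatedBound n (p n) q) atTop
      (𝓝 (Real.exp (-((1 - q) * Real.exp (-c))))) := by
  have h1 : Tendsto (fun n : ℕ => (1 + -((1 - q) * (1 - p n) ^ (n - 2))) ^ n) atTop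
      (𝓝 (Real.exp (-((1 - q) * Real.exp (-c))))) := by
    refine Real.tendsto_one_add_pow_exp_of_tendsto ?_
    refine (((tendsto_nat_mul_one_sub_pow_sub hp hlim 2).const_mul (1 - q)).neg).congr fun n => ?_
    ring
  have h2 : Tendsto (fun n : ℕ => 1 - (1 - q) * (1 - p n) ^ (n - 2)) atTop (𝓝 1) := by
    simpa using ((tendsto_one_sub_pow_sub hp hlim 2).const_mul (1 - q)).const_sub 1
  have h3 := ((tendsto_one_sub_pow_sub hp hlim 1).const_sub 1).mul
    (h1.div (h2.pow 2) (by simp))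
  simp only [sub_zero, one_pow, div_one, one_mul] at h3
  refine h3.congr' ?_
  filter_upwards [eventually_ge_atTop 2,
    h2.eventually_const_lt (show (0 : ℝ) < 1 by norm_num)] with n hn hpos
  rw [noIsolatedBound, Pi.div_apply]
  congr 1
  rw [div_eq_iff (pow_ne_zero _ hpos.ne'), ← pow_add, Nat.sub_add_cancel hn, ← sub_eq_add_neg]

lemma obstructionBound_le {n k : ℕ} {p C : ℝ} (hp : p ∈ Set.Icc (0 : ℝ) 1) (hn : 24 ≤ n)
    (hk : 2 ≤ k) (hkn : k ≤ n / 2) (hC : Real.log n ≤ C + n * p) :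
    obstructionBound n p k ≤
      Real.exp C * ((1 + n * p) ^ 2 * Real.exp 2 * Real.exp (-(n * p / 8))) ^ k := by
  have hn' : (24 : ℝ) ≤ n := by exact_mod_cast hn
  have hk' : (2 : ℝ) ≤ k := by exact_mod_cast hk
  have hkn' : 2 * (k : ℝ) ≤ n := by exact_mod_cast (by omega : 2 * k ≤ n)
  have hp0 := hp.1
  have hcast : ((n - k - 1 : ℕ) : ℝ) = n - k - 1 := by
    rw [Nat.cast_sub (by omega), Nat.cast_sub (by omega), Nat.cast_one]
  have h1 : (n : ℝ) ≤ Real.exp (C + n * p) := by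
    rw [← Real.log_le_iff_le_exp (by linarith)]
    exact hC
  have h2 : (1 - p) ^ (k * (n - k - 1)) ≤ Real.exp (-(n * p) - k * (n * p / 8)) := by
    calc (1 - p) ^ (k * (n - k - 1)) ≤ Real.exp (-p) ^ (k * (n - k - 1)) :=
          pow_le_pow_left₀ (sub_nonneg.2 hp.2) (Real.one_sub_le_exp_neg p) _
      _ = Real.exp (-(p * (k * (n - k - 1)))) := by
          rw [← Real.exp_nat_mul, Nat.cast_mul, hcast]
          congr 1
          ring
      _ ≤ _ := by
          refine Real.exp_le_exp.2 ?_
          have h3 : (n : ℝ) + k * n / 8 ≤ k * (n - k - 1) := by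
            nlinarith [mul_nonneg (sub_nonneg.2 hk') (by linarith : (0 : ℝ) ≤ n / 2 - k)]
          nlinarith [mul_le_mul_of_nonneg_left h3 hp0]
  have h4 : Real.exp (C + n * p) * Real.exp (-(n * p) - k * (n * p / 8)) =
      Real.exp C * Real.exp (-(n * p / 8)) ^ k := by
    rw [← Real.exp_nat_mul, ← Real.exp_add, ← Real.exp_add]
    congr 1
    ring
  calc obstructionBound n p k
      ≤ Real.exp (C + n * p) * ((1 + n * p) ^ 2 * Real.exp 2) ^ k *
          Real.exp (-(n * p) - k * (n * p / 8)) := by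
        unfold obstructionBound
        refine mul_le_mul (mul_le_mul_of_nonneg_right h1 (by positivity)) h2
          (pow_nonneg (sub_nonneg.2 hp.2) _) (by positivity)
    _ = _ := by
        rw [mul_pow _ (Real.exp (-(n * p / 8))), mul_right_comm, h4]
        ring

lemma tendsto_sum_obstructionBound (hp : ∀ n, p n ∈ Set.Icc (0 : ℝ) 1)
    (hlim : Tendsto (fun n : ℕ => (n : ℝ) * p n - Real.log n) atTop (𝓝 c)) :
    Tendsto (fun n : ℕ => ∑ k ∈ Finset.Icc 2 (n / 2), obstructionBound n (p n) k) atTop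
      (𝓝 0) := by
  let x : ℕ → ℝ := fun n =>
    (1 + n * p n) ^ 2 * Real.exp 2 * Real.exp (-(n * p n / 8))
  have hx0 : ∀ n, 0 ≤ x n := fun n => by positivity
  have hx : Tendsto x atTop (𝓝 0) := by
    have h1 : Tendsto (fun n : ℕ => (1 + n * p n) / 8) atTop atTop :=
      (tendsto_atTop_add_const_left _ 1 (tendsto_nat_mul_atTop hlim)).atTop_div_const (by norm_num)
    have h2 := ((Real.tendsto_pow_mul_exp_neg_atTop_nhds_zero 2).comp h1).const_mul
      (64 * Real.exp 2 * Real.exp (1 / 8))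
    rw [mul_zero] at h2
    refine h2.congr fun n => ?_
    have h3 : Real.exp (-(n * p n / 8)) =
        Real.exp (1 / 8) * Real.exp (-((1 + n * p n) / 8)) := by
      rw [← Real.exp_add]
      congr 1
      ring
    simp only [x, h3, Function.comp_apply]
    ring
  have hbound : Tendsto (fun n => Real.exp (1 - c) * (x n ^ 2 / (1 - x n))) atTop (𝓝 0) := by
    have := ((hx.pow 2).div (hx.const_sub 1) (by simp)).const_mul (Real.exp (1 - c))
    simpa using this
  refine squeeze_zero' (Eventually.of_forall fun n => Finset.sum_nonneg fun k _ => ?_) ?_ hbound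
  · have h1 := (hp n).1
    have h2 := sub_nonneg.2 (hp n).2
    unfold obstructionBound
    positivity
  filter_upwards [hlim.eventually_const_lt (show c - 1 < c by linarith), eventually_ge_atTop 24,
    hx.eventually_lt_const (show (0 : ℝ) < 1 by norm_num)] with n hn hn24 hx1
  calc ∑ k ∈ Finset.Icc 2 (n / 2), obstructionBound n (p n) k
      ≤ ∑ k ∈ Finset.Icc 2 (n / 2), Real.exp (1 - c) * x n ^ k := by
        refine Finset.sum_le_sum fun k hk => ?_
        rw [Finset.mem_Icc] at hk
        exact obstructionBound_le (hp n) hn24 hk.1 hk.2 (by linarith)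
    _ = Real.exp (1 - c) * ∑ k ∈ Finset.Ico 2 (n / 2 + 1), x n ^ k := by
        rw [← Finset.mul_sum]
        rfl
    _ ≤ _ := mul_le_mul_of_nonneg_left (geom_sum_Ico_le_of_lt_one (hx0 n) hx1)
        (Real.exp_pos _).le

lemma tendsto_defectBound (q : ℝ) (hp : ∀ n, p n ∈ Set.Icc (0 : ℝ) 1)
    (hlim : Tendsto (fun n : ℕ => (n : ℝ) * p n - Real.log n) atTop (𝓝 c)) :
    Tendsto (fun n : ℕ => defectBound n (p n) q) atTop
      (𝓝 ((1 - q) ^ 2 * Real.exp (-(2 * (1 - q) * Real.exp (-c))) * Real.exp (-(2 * c)))) := by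
  have h1 := tendsto_nat_mul_one_sub_pow_sub hp hlim 1
  have h2 := (tendsto_nat_mul_one_sub_pow_sub hp hlim 2).sub (tendsto_one_sub_pow_sub hp hlim 2)
  have h3 := ((tendsto_noIsolatedBound q hp hlim).pow 2).sub
    ((tendsto_sum_obstructionBound hp hlim).const_mul 2)
  have h := ((h1.mul h2).const_mul ((1 - q) ^ 2)).mul h3
  convert h using 2 with n
  · unfold defectBound
    ring
  · rw [sub_zero, mul_zero, sub_zero, ← Real.exp_add, ← Real.exp_nat_mul, mul_right_comm]
    congr 3 <;> push_cast <;> ring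

end Asymptotics

/-- If `n·p_n - log n → c` and `q ∈ [0,1]` is constant, then
`limsup P(G_{n,p_n,q} ∈ D^n) ≤ 1 - (1-q)²·exp(-2(1-q)e^{-c})·e^{-2c}`. -/
theorem limsup_prob_structurallyDiagonalizable_selfloop_le (c : ℝ) (q : ℝ)
    (hq : q ∈ Set.Icc (0 : ℝ) 1) (p : ℕ → ℝ)
    (hp : ∀ n, p n ∈ Set.Icc (0 : ℝ) 1)
    (hlim : Tendsto (fun n : ℕ => (n : ℝ) * p n - Real.log n) atTop (nhds c)) :
    limsup (fun n : ℕ =>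
        digraphProb n (p n) q {E | StructurallyDiagonalizable n E}) atTop
      ≤ 1 - (1 - q) ^ 2 * Real.exp (-(2 * (1 - q) * Real.exp (-c))) *
          Real.exp (-(2 * c)) := by
  have hbound := (tendsto_defectBound q hp hlim).const_sub 1
  rw [← hbound.limsup_eq]
  refine limsup_le_limsup ?_ ?_ hbound.isBoundedUnder_le
  · filter_upwards [(tendsto_nat_mul_atTop hlim).eventually_gt_atTop 0] with n hn
    have hp0 : 0 < p n := (hp n).1.lt_of_ne fun h => by simp [← h] at hn
    exact digraphProb_structurallyDiagonalizable_le hp0 (hp n).2 hq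
  · refine IsBoundedUnder.isCoboundedUnder_le
      ⟨0, eventually_map.2 (Eventually.of_forall fun n => ?_)⟩
    rw [digraphProb_eq_subsetProb]
    exact subsetProb_nonneg (edgeProb_mem_Icc (hp n) hq) _
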